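/- arXiv:2202.03637 — 8 statements merged into one kernel-verified Lean document; each statement's English description precedes it below -/
import Mathlib

section
/- For every formula φ ∈ L^Kw, every valuation v ∈ V, and every strategy profile s ∈ S: v,s ⊨ φ if and only if s ⊨ φ (that is, the truth of a knowing-whether formula does not depend on the valuation: if v,s ⊨ φ for some v ∈ V then w,s ⊨ φ for all w ∈ V). -/
open Classical

/-! ## Basic setting: players, variables, strategies, observation relations -/

/-- A strategy for player `i`: it assigns to each player `j` the set of variables
(all observed/owned by `i`) that `i` reveals to `j`, where `i` "reveals" all of its
own variables to itself. -/
structure Strategy {ι P : Type} (owner : P → ι) (i : ι) where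
  reveal : ι → Set P
  reveal_subset : ∀ j, reveal j ⊆ {p | owner p = i}
  reveal_self : reveal i = {p | owner p = i}

/-- A strategy profile: one strategy per player. -/
abbrev Profile {ι P : Type} (owner : P → ι) : Type := ∀ i, Strategy owner i

/-- `P_i(s)`: the set of variables revealed to player `i` in profile `s`. -/
def revealedTo {ι P : Type} (owner : P → ι) (s : Profile owner) (i : ι) : Set P :=
  {p | ∃ j, p ∈ (s j).reveal i}

/-- The observation relation `v ∼_i^s w`. -/
def obsRel {ι P : Type} (owner : P → ι) (s : Profile owner) (i : ι) (v w : Set P) : Prop :=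
  v ∩ revealedTo owner s i = w ∩ revealedTo owner s i

/-- The initial observation relation `v ∼_i w`. -/
def obsInit {ι P : Type} (owner : P → ι) (i : ι) (v w : Set P) : Prop :=
  v ∩ {p | owner p = i} = w ∩ {p | owner p = i}

/-! ## The epistemic language `L^K` and its semantics -/

/-- The epistemic language `L^K`: atoms, negation, disjunction, knowledge. -/
inductive Form (ι P : Type) : Type where
  | atom : P → Form ι P
  | neg : Form ι P → Form ι P
  | or : Form ι P → Form ι P → Form ι P
  | know : ι → Form ι P → Form ι P

/-- Conjunction, defined by abbreviation. -/
def Form.and {ι P : Type} (α β : Form ι P) : Form ι P := .neg (.or (.neg α) (.neg β))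

/-- `K̂_i α := ¬ K_i ¬ α`. -/
def Form.hatK {ι P : Type} (i : ι) (α : Form ι P) : Form ι P := .neg (.know i (.neg α))

/-- `Kw_i α := K_i α ∨ K_i ¬ α`. -/
def Form.Kw {ι P : Type} (i : ι) (α : Form ι P) : Form ι P :=
  .or (.know i α) (.know i (.neg α))

/-- Satisfaction `v,s ⊨ α`. -/
def sat {ι P : Type} (owner : P → ι) : Set P → Profile owner → Form ι P → Prop
  | v, _, .atom p => p ∈ v
  | v, s, .neg α => ¬ sat owner v s α
  | v, s, .or α β => sat owner v s α ∨ sat owner v s β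
  | v, s, .know i α => ∀ w, obsRel owner s i v w → sat owner w s α

/-- The fragment `L^Kw` of knowing-whether formulas (as a subset of `L^K`). -/
inductive IsKw {ι P : Type} : Form ι P → Prop
  | kw (j : ι) (p : P) : IsKw (Form.Kw j (.atom p))
  | neg {α : Form ι P} : IsKw α → IsKw (.neg α)
  | or {α β : Form ι P} : IsKw α → IsKw β → IsKw (.or α β)

/-- The fragment `L^K_nnf` of formulas in negation normal form. -/
inductive IsNNF {ι P : Type} : Form ι P → Prop
  | atom (p : P) : IsNNF (.atom p)
  | natom (p : P) : IsNNF (.neg (.atom p))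
  | and {α β : Form ι P} : IsNNF α → IsNNF β → IsNNF (Form.and α β)
  | or {α β : Form ι P} : IsNNF α → IsNNF β → IsNNF (.or α β)
  | know {α : Form ι P} (i : ι) : IsNNF α → IsNNF (.know i α)
  | hatK {α : Form ι P} (i : ι) : IsNNF α → IsNNF (Form.hatK i α)

/-- The fragment `L^Kw_nnf`. -/
inductive IsKwNNF {ι P : Type} : Form ι P → Prop
  | kw (j : ι) (p : P) : IsKwNNF (Form.Kw j (.atom p))
  | nkw (j : ι) (p : P) : IsKwNNF (.neg (Form.Kw j (.atom p)))
  | or {α β : Form ι P} : IsKwNNF α → IsKwNNF β → IsKwNNF (.or α β)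
  | and {α β : Form ι P} : IsKwNNF α → IsKwNNF β → IsKwNNF (Form.and α β)

/-! ## Uniform strategies, expected outcomes, Nash equilibria -/

/-- A uniform strategy profile assigns to each player a map from valuations to strategies. -/
abbrev UProfile {ι P : Type} (owner : P → ι) : Type := ∀ i, Set P → Strategy owner i

/-- Uniformity: the same strategy on indistinguishable valuations. -/
def IsUniform {ι P : Type} (owner : P → ι) (i : ι) (f : Set P → Strategy owner i) : Prop :=
  ∀ v w, obsInit owner i v w → f v = f w

/-- Global uniformity: the same strategy on all valuations. -/
def IsGUniform {ι P : Type} (owner : P → ι) (i : ι) (f : Set P → Strategy owner i) : Prop :=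
  ∀ v w, f v = f w

/-- The strategy profile `us(v)` determined by a uniform strategy profile at valuation `v`. -/
def applyU {ι P : Type} (owner : P → ι) (us : UProfile owner) (v : Set P) : Profile owner :=
  fun i => us i v

/-- The outcome `u_i(v,s)`: `1` if player `i`'s goal (described by `win`) holds, else `0`. -/
noncomputable def outcome {ι P : Type} (owner : P → ι)
    (win : ι → Set P → Profile owner → Prop) (i : ι) (v : Set P) (s : Profile owner) : ℕ :=
  if win i v s then 1 else 0

/-- Nash equilibrium of the pointed game `G(v)`. -/
def pointedNE {ι P : Type} [DecidableEq ι] (owner : P → ι)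
    (win : ι → Set P → Profile owner → Prop) (v : Set P) (s : Profile owner) : Prop :=
  ∀ (i : ι) (s' : Strategy owner i),
    outcome owner win i v s ≥ outcome owner win i v (Function.update s i s')

/-- `min 𝐮_i(v,us)`: the minimum of the expected outcome of player `i` over its
information set (a vector of `0`s and `1`s). -/
noncomputable def pessVal {ι P : Type} (owner : P → ι)
    (win : ι → Set P → Profile owner → Prop) (i : ι) (v : Set P) (us : UProfile owner) : ℕ :=
  if ∀ w, obsInit owner i v w → outcome owner win i w (applyU owner us w) = 1 then 1 else 0

/-- `max 𝐮_i(v,us)`: the maximum of the expected outcome of player `i` over its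
information set. -/
noncomputable def optVal {ι P : Type} (owner : P → ι)
    (win : ι → Set P → Profile owner → Prop) (i : ι) (v : Set P) (us : UProfile owner) : ℕ :=
  if ∃ w, obsInit owner i v w ∧ outcome owner win i w (applyU owner us w) = 1 then 1 else 0

/-- The maximal outcome relation `𝐮_i(v,us) >^max 𝐮_i(v,us')`. -/
def maxGt {ι P : Type} (owner : P → ι) (win : ι → Set P → Profile owner → Prop)
    (i : ι) (v : Set P) (us us' : UProfile owner) : Prop :=
  ∃ w, obsInit owner i v w ∧
    outcome owner win i w (applyU owner us w) > outcome owner win i w (applyU owner us' w)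

/-- Maximal Nash equilibrium: a uniform strategy profile from which no player has a
profitable deviation w.r.t. the maximal outcome relation. -/
def NEmax {ι P : Type} [DecidableEq ι] (owner : P → ι)
    (win : ι → Set P → Profile owner → Prop) (us : UProfile owner) : Prop :=
  (∀ i, IsUniform owner i (us i)) ∧
  ∀ (i : ι) (f : Set P → Strategy owner i), IsUniform owner i f →
    ∀ v, ¬ maxGt owner win i v (Function.update us i f) us

/-- Pessimist Nash equilibrium. -/
def NEpess {ι P : Type} [DecidableEq ι] (owner : P → ι)
    (win : ι → Set P → Profile owner → Prop) (us : UProfile owner) : Prop :=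
  (∀ i, IsUniform owner i (us i)) ∧
  ∀ (i : ι) (f : Set P → Strategy owner i), IsUniform owner i f →
    ∀ v, ¬ (pessVal owner win i v (Function.update us i f) > pessVal owner win i v us)

/-- Optimist Nash equilibrium. -/
def NEopt {ι P : Type} [DecidableEq ι] (owner : P → ι)
    (win : ι → Set P → Profile owner → Prop) (us : UProfile owner) : Prop :=
  (∀ i, IsUniform owner i (us i)) ∧
  ∀ (i : ι) (f : Set P → Strategy owner i), IsUniform owner i f →
    ∀ v, ¬ (optVal owner win i v (Function.update us i f) > optVal owner win i v us)

/-! ## Boolean formulas and knowing-whether formulas -/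

/-- Boolean formulas `L^B` over a set of variables. -/
inductive BForm (P : Type) : Type where
  | atom : P → BForm P
  | neg : BForm P → BForm P
  | or : BForm P → BForm P → BForm P

/-- Classical propositional satisfaction of Boolean formulas. -/
def bsat {P : Type} (v : Set P) : BForm P → Prop
  | .atom p => p ∈ v
  | .neg α => ¬ bsat v α
  | .or α β => bsat v α ∨ bsat v β

/-- The language `L^Kw` of knowing-whether formulas (as a language of its own). -/
inductive KwForm (ι P : Type) : Type where
  | kw : ι → P → KwForm ι P
  | neg : KwForm ι P → KwForm ι P
  | or : KwForm ι P → KwForm ι P → KwForm ι P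

/-- `Kw_j p` holds at `(v,s)`: player `j` knows whether `p`. -/
def kwHolds {ι P : Type} (owner : P → ι) (v : Set P) (s : Profile owner)
    (j : ι) (p : P) : Prop :=
  (∀ w, obsRel owner s j v w → p ∈ w) ∨ (∀ w, obsRel owner s j v w → p ∉ w)

/-- Epistemic satisfaction of knowing-whether formulas. -/
def ksat {ι P : Type} (owner : P → ι) : Set P → Profile owner → KwForm ι P → Prop
  | v, s, .kw j p => kwHolds owner v s j p
  | v, s, .neg α => ¬ ksat owner v s α
  | v, s, .or α β => ksat owner v s α ∨ ksat owner v s β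

/-! ## From Boolean games to Kw games -/

/-- The translation `λ : L^B → L^Kw`, mapping `p_i` to `Kw_{i⁺} p_i` where `i⁺` is the
(cyclic) successor of `i`. -/
def lam {P : Type} {n : ℕ} [NeZero n] (owner : P → Fin n) : BForm P → KwForm (Fin n) P
  | .atom p => .kw (owner p + 1) p
  | .neg α => .neg (lam owner α)
  | .or α β => .or (lam owner α) (lam owner β)

/-- The strategy profile `s^w` associated with a valuation `w`: each player `i` reveals
(to its cyclic successor `i⁺`, and no one else) exactly its variables that are in `w`. -/
def profOf {P : Type} {n : ℕ} [NeZero n] (owner : P → Fin n) (w : Set P) :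
    Profile owner := fun i =>
  { reveal := fun j =>
      if j = i then {p | owner p = i}
      else if j = i + 1 then {p | owner p = i ∧ p ∈ w}
      else ∅
    reveal_subset := by
      intro j
      by_cases h1 : j = i
      · rw [if_pos h1]
      · rw [if_neg h1]
        by_cases h2 : j = i + 1
        · rw [if_pos h2]; exact fun p hp => hp.1
        · rw [if_neg h2]; exact fun p hp => absurd hp (Set.notMem_empty p)
    reveal_self := by rw [if_pos rfl] }

/-- Outcome function of a Boolean game. -/
noncomputable def bOutcome {ι P : Type} (owner : P → ι) (γ : ι → BForm P)
    (i : ι) (v : Set P) : ℕ :=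
  if bsat v (γ i) then 1 else 0

/-- The valuation `(v'_i, v_{-i})` resulting from player `i` deviating, in a Boolean
game, to the local valuation `vi` (only the part of `vi` inside `P_i` matters). -/
def bDeviate {ι P : Type} (owner : P → ι) (v : Set P) (i : ι) (vi : Set P) : Set P :=
  {p | if owner p = i then p ∈ vi else p ∈ v}

/-- Nash equilibrium of a Boolean game. -/
def BNE {ι P : Type} (owner : P → ι) (γ : ι → BForm P) (v : Set P) : Prop :=
  ∀ (i : ι) (vi : Set P), bOutcome owner γ i v ≥ bOutcome owner γ i (bDeviate owner v i vi)

/-! ## Globally uniform strategy profiles, the equivalence `≡`, and `χ` -/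

/-- The set `𝐒^g` of globally uniform strategy profiles. -/
def GProfile {ι P : Type} (owner : P → ι) : Type :=
  {us : UProfile owner // ∀ i, IsGUniform owner i (us i)}

/-- The equivalence `ṡ ≡ ṫ iff s_i(i⁺) = t_i(i⁺) for all i` on globally uniform
strategy profiles. -/
def gSetoid {P : Type} {n : ℕ} [NeZero n] (owner : P → Fin n) :
    Setoid (GProfile owner) where
  r us ut := ∀ i, (us.1 i ∅).reveal (i + 1) = (ut.1 i ∅).reveal (i + 1)
  iseqv := ⟨fun _ _ => rfl, fun h i => (h i).symm, fun h h' i => (h i).trans (h' i)⟩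

/-- The map `χ : V → 𝐒^g/≡`, `χ(v) = [ṡ^v]`. -/
def chi {P : Type} {n : ℕ} [NeZero n] (owner : P → Fin n) (w : Set P) :
    Quotient (gSetoid owner) :=
  Quotient.mk (gSetoid owner) ⟨fun i _ => profOf owner w i, fun _ _ _ => rfl⟩

/-! ## From Kw games to Boolean games -/

/-- The set `Q` of variables of the Boolean game associated with a Kw game:
pairs `(j,p)` standing for the atom `Kw_j p` with `j ≠ owner p`. -/
def QVar {ι P : Type} (owner : P → ι) : Type := {q : ι × P // q.1 ≠ owner q.2}

/-- Classical propositional satisfaction of knowing-whether formulas read as Boolean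
formulas over the atoms `Q`. -/
def kbsat {ι P : Type} (owner : P → ι) (w : Set (QVar owner)) : KwForm ι P → Prop
  | .kw j p => ∃ h : j ≠ owner p, (⟨(j, p), h⟩ : QVar owner) ∈ w
  | .neg α => ¬ kbsat owner w α
  | .or α β => kbsat owner w α ∨ kbsat owner w β

/-- A knowing-whether formula contains no trivial constituent `Kw_i p_i`. -/
inductive NoTrivial {ι P : Type} (owner : P → ι) : KwForm ι P → Prop
  | kw {j : ι} {p : P} : j ≠ owner p → NoTrivial owner (.kw j p)
  | neg {α : KwForm ι P} : NoTrivial owner α → NoTrivial owner (.neg α)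
  | or {α β : KwForm ι P} :
      NoTrivial owner α → NoTrivial owner β → NoTrivial owner (.or α β)

/-- The map `η` on strategy profiles: `Kw_j p ∈ η(ṡ)` iff `p ∈ s_{owner p}(j)`. -/
def etaP {ι P : Type} (owner : P → ι) (s : Profile owner) : Set (QVar owner) :=
  {q | q.1.2 ∈ (s (owner q.1.2)).reveal q.1.1}

/-- The map `η : 𝐒^g → W` on globally uniform strategy profiles. -/
def etaG {ι P : Type} (owner : P → ι) (us : GProfile owner) : Set (QVar owner) :=
  etaP owner (fun i => us.1 i ∅)

/-- Outcome of the associated Boolean game `B_G` (variables `Q`, goals read as Boolean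
formulas over `Q`). -/
noncomputable def ubq {ι P : Type} (owner : P → ι) (γ : ι → KwForm ι P)
    (i : ι) (w : Set (QVar owner)) : ℕ :=
  if kbsat owner w (γ i) then 1 else 0

/-- Deviation by player `i` in `B_G` (player `i` controls `Q_i = {Kw_j p | owner p = i}`). -/
def bDeviateQ {ι P : Type} (owner : P → ι) (w : Set (QVar owner)) (i : ι)
    (wi : Set (QVar owner)) : Set (QVar owner) :=
  {q | if owner q.1.2 = i then q ∈ wi else q ∈ w}

/-- Nash equilibrium of the Boolean game `B_G`. -/
def BNEQ {ι P : Type} (owner : P → ι) (γ : ι → KwForm ι P) (w : Set (QVar owner)) : Prop :=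
  ∀ (i : ι) (wi : Set (QVar owner)), ubq owner γ i w ≥ ubq owner γ i (bDeviateQ owner w i wi)

/-! ## Negation normal form languages as languages of their own -/

/-- The language `L^K_nnf` in negation normal form, as a language of its own. -/
inductive NForm (ι P : Type) : Type where
  | atom : P → NForm ι P
  | natom : P → NForm ι P
  | and : NForm ι P → NForm ι P → NForm ι P
  | or : NForm ι P → NForm ι P → NForm ι P
  | know : ι → NForm ι P → NForm ι P
  | hatK : ι → NForm ι P → NForm ι P

/-- Satisfaction for `NForm`. -/
def nsat {ι P : Type} (owner : P → ι) : Set P → Profile owner → NForm ι P → Prop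
  | v, _, .atom p => p ∈ v
  | v, _, .natom p => p ∉ v
  | v, s, .and α β => nsat owner v s α ∧ nsat owner v s β
  | v, s, .or α β => nsat owner v s α ∨ nsat owner v s β
  | v, s, .know i α => ∀ w, obsRel owner s i v w → nsat owner w s α
  | v, s, .hatK i α => ∃ w, obsRel owner s i v w ∧ nsat owner w s α

/-- The positive fragment `L^+` (no `K̂` modalities). -/
inductive IsPositive {ι P : Type} : NForm ι P → Prop
  | atom (p : P) : IsPositive (.atom p)
  | natom (p : P) : IsPositive (.natom p)
  | and {α β : NForm ι P} : IsPositive α → IsPositive β → IsPositive (.and α β)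
  | or {α β : NForm ι P} : IsPositive α → IsPositive β → IsPositive (.or α β)
  | know {α : NForm ι P} (i : ι) : IsPositive α → IsPositive (.know i α)

/-- The self-positive fragment `L^{j+}`: all occurrences of `K_j` are positive. -/
inductive SelfPos {ι P : Type} (j : ι) : NForm ι P → Prop
  | atom (p : P) : SelfPos j (.atom p)
  | natom (p : P) : SelfPos j (.natom p)
  | and {α β : NForm ι P} : SelfPos j α → SelfPos j β → SelfPos j (.and α β)
  | or {α β : NForm ι P} : SelfPos j α → SelfPos j β → SelfPos j (.or α β)
  | know {α : NForm ι P} (k : ι) : SelfPos j α → SelfPos j (.know k α)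
  | hatK {α : NForm ι P} {k : ι} : k ≠ j → SelfPos j α → SelfPos j (.hatK k α)

/-- `pol owner j φ = (+^j(φ), −^j(φ))`: positive / negative epistemic assertions
about variables of player `j` in the NNF formula `φ`. -/
def pol {ι P : Type} (owner : P → ι) (j : ι) : NForm ι P → Prop × Prop
  | .atom p => (owner p = j, False)
  | .natom p => (owner p = j, False)
  | .and α β => ((pol owner j α).1 ∨ (pol owner j β).1, (pol owner j α).2 ∨ (pol owner j β).2)
  | .or α β => ((pol owner j α).1 ∨ (pol owner j β).1, (pol owner j α).2 ∨ (pol owner j β).2)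
  | .know _ α => pol owner j α
  | .hatK _ α => ((pol owner j α).2, (pol owner j α).1)

/-- `|type(i)|`: the number of elements of `type(i) ⊆ {+, −, c+, c−}`. -/
noncomputable def typeCard {ι P : Type} (owner : P → ι) (γ : ι → NForm ι P) (i : ι) : ℕ :=
  (if ∃ j, j ≠ i ∧ (pol owner j (γ i)).1 then 1 else 0) +
  (if ∃ j, j ≠ i ∧ (pol owner j (γ i)).2 then 1 else 0) +
  (if (pol owner i (γ i)).1 then 1 else 0) +
  (if (pol owner i (γ i)).2 then 1 else 0)

/-- The language `L^Kw_nnf` as a language of its own. -/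
inductive KwNForm (ι P : Type) : Type where
  | kw : ι → P → KwNForm ι P
  | nkw : ι → P → KwNForm ι P
  | and : KwNForm ι P → KwNForm ι P → KwNForm ι P
  | or : KwNForm ι P → KwNForm ι P → KwNForm ι P

/-- Satisfaction for `KwNForm`. -/
def knsat {ι P : Type} (owner : P → ι) : Set P → Profile owner → KwNForm ι P → Prop
  | v, s, .kw j p => kwHolds owner v s j p
  | v, s, .nkw j p => ¬ kwHolds owner v s j p
  | v, s, .and α β => knsat owner v s α ∧ knsat owner v s β
  | v, s, .or α β => knsat owner v s α ∨ knsat owner v s β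

/-- Polarity for `KwNForm`. -/
def kpol {ι P : Type} (owner : P → ι) (j : ι) : KwNForm ι P → Prop × Prop
  | .kw _ p => (owner p = j, False)
  | .nkw _ p => (False, owner p = j)
  | .and α β =>
      ((kpol owner j α).1 ∨ (kpol owner j β).1, (kpol owner j α).2 ∨ (kpol owner j β).2)
  | .or α β =>
      ((kpol owner j α).1 ∨ (kpol owner j β).1, (kpol owner j α).2 ∨ (kpol owner j β).2)

/-- `|type(i)|` for Kw games. -/
noncomputable def ktypeCard {ι P : Type} (owner : P → ι) (γ : ι → KwNForm ι P) (i : ι) : ℕ :=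
  (if ∃ j, j ≠ i ∧ (kpol owner j (γ i)).1 then 1 else 0) +
  (if ∃ j, j ≠ i ∧ (kpol owner j (γ i)).2 then 1 else 0) +
  (if (kpol owner i (γ i)).1 then 1 else 0) +
  (if (kpol owner i (γ i)).2 then 1 else 0)

/-- The strategy profile `s^∀` in which everybody reveals everything to everyone. -/
def allProf {ι P : Type} (owner : P → ι) : Profile owner := fun i =>
  { reveal := fun _ => {p | owner p = i}
    reveal_subset := fun _ _ hp => hp
    reveal_self := rfl }

theorem kw_atom_iff {ι P : Type} (owner : P → ι) (s : Profile owner) (j : ι) (p : P)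
    (v : Set P) :
    sat owner v s (Form.Kw j (.atom p)) ↔ p ∈ revealedTo owner s j := by
  simp only [Form.Kw, sat]
  constructor
  · intro h
    by_contra hp
    have h1 : obsRel owner s j v (v ∪ {p}) := by
      unfold obsRel
      ext q
      by_cases hq : q = p
      · subst hq; simp [hp]
      · simp [hq]
    have h2 : obsRel owner s j v (v \ {p}) := by
      unfold obsRel
      ext q
      by_cases hq : q = p
      · subst hq; simp [hp]
      · simp [hq]
    rcases h with h | h
    · exact (h _ h2).2 rfl
    · exact h _ h1 (Or.inr rfl)
  · intro hp
    have key : ∀ w, obsRel owner s j v w → (p ∈ v ↔ p ∈ w) := by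
      intro w hw
      have := Set.ext_iff.mp hw p
      simpa [hp] using this
    by_cases hv : p ∈ v
    · exact Or.inl fun w hw => (key w hw).mp hv
    · exact Or.inr fun w hw hpw => hv ((key w hw).mpr hpw)

theorem kw_indep_aux {ι P : Type} (owner : P → ι) (s : Profile owner)
    (φ : Form ι P) (hφ : IsKw φ) (v w : Set P) :
    sat owner v s φ ↔ sat owner w s φ := by
  induction hφ with
  | kw j p => rw [kw_atom_iff, kw_atom_iff]
  | neg _ ih => simp only [sat, ih]
  | or _ _ ih1 ih2 => simp only [sat, ih1, ih2]

/-- the truth of a knowing-whether formula does not depend on the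
valuation: `v,s ⊨ φ` iff `s ⊨ φ`. -/
theorem kw_valuation_independent {ι P : Type} [Fintype ι] [Fintype P] (owner : P → ι)
    (φ : Form ι P) (hφ : IsKw φ) (v : Set P) (s : Profile owner) :
    sat owner v s φ ↔ ∀ w : Set P, sat owner w s φ := by
  exact ⟨fun h w => (kw_indep_aux owner s φ hφ v w).mp h, fun h => h v⟩
end

section
/- For every formula α ∈ L^Kw and every player i ∈ N, the equivalence α ↔ K_i α is valid: for all valuations v ∈ V and all strategy profiles s ∈ S, v,s ⊨ α if and only if v,s ⊨ K_i α. -/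
open Classical

/-- `Kw_j p` holds iff `p` is revealed to `j`. -/
theorem sat_kw_iff {ι P : Type} (owner : P → ι) (v : Set P) (s : Profile owner) (j : ι) (p : P) :
    sat owner v s (Form.Kw j (.atom p)) ↔ p ∈ revealedTo owner s j := by
  simp only [Form.Kw, sat]
  constructor
  · intro h
    by_contra hp
    have h1 : obsRel owner s j v (v ∪ {p}) := by
      unfold obsRel
      ext q
      simp only [Set.mem_inter_iff, Set.mem_union, Set.mem_singleton_iff]
      constructor
      · rintro ⟨a, b⟩
        exact ⟨Or.inl a, b⟩
      · rintro ⟨a | a, b⟩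
        · exact ⟨a, b⟩
        · exact absurd (a ▸ b) hp
    have h2 : obsRel owner s j v (v \ {p}) := by
      unfold obsRel
      ext q
      simp only [Set.mem_inter_iff, Set.mem_diff, Set.mem_singleton_iff]
      constructor
      · rintro ⟨a, b⟩
        exact ⟨⟨a, fun e => hp (e ▸ b)⟩, b⟩
      · rintro ⟨⟨a, _⟩, b⟩
        exact ⟨a, b⟩
    rcases h with h | h
    · exact (h _ h2).2 rfl
    · exact h _ h1 (Or.inr rfl)
  · intro hp
    have key : ∀ w, obsRel owner s j v w → (p ∈ v ↔ p ∈ w) := by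
      intro w hw
      have := Set.ext_iff.mp hw p
      simpa [hp] using this
    by_cases hv : p ∈ v
    · exact Or.inl fun w hw => (key w hw).1 hv
    · exact Or.inr fun w hw h => hv ((key w hw).2 h)

/-- The truth of knowing-whether formulas does not depend on the valuation. -/
theorem sat_kw_indep {ι P : Type} (owner : P → ι) (s : Profile owner) (α : Form ι P)
    (hα : IsKw α) (v w : Set P) : sat owner v s α ↔ sat owner w s α := by
  induction hα with
  | kw j p => rw [sat_kw_iff, sat_kw_iff]
  | neg _ ih => simp only [sat]; rw [ih]
  | or _ _ ih1 ih2 => simp only [sat]; rw [ih1, ih2]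

/-- for `α ∈ L^Kw` and any player `i`, `α ↔ K_i α` is valid. -/
theorem kw_know_equiv {ι P : Type} [Fintype ι] [Fintype P] (owner : P → ι)
    (α : Form ι P) (hα : IsKw α) (i : ι) (v : Set P) (s : Profile owner) :
    sat owner v s α ↔ sat owner v s (.know i α) := by
  constructor
  · intro h w _
    exact (sat_kw_indep owner s α hα v w).1 h
  · intro h
    exact h v rfl
end

section
/- For all players i, j, k ∈ N and every variable p_k ∈ P_k, the formula Kw_i Kw_j p_k is valid: for all valuations v ∈ V and all strategy profiles s ∈ S, v,s ⊨ Kw_i Kw_j p_k. -/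
open Classical

theorem sat_kw_atom_iff {ι P : Type} (owner : P → ι) (j : ι) (p : P) (v : Set P)
    (s : Profile owner) :
    sat owner v s (Form.Kw j (.atom p)) ↔ p ∈ revealedTo owner s j := by
  simp only [Form.Kw, sat, obsRel]
  constructor
  · intro h
    by_contra hn
    have key : ∀ w : Set P, (∀ q, q ≠ p → (q ∈ v ↔ q ∈ w)) →
        v ∩ revealedTo owner s j = w ∩ revealedTo owner s j := by
      intro w hw
      ext q
      by_cases hq : q = p
      · subst hq
        simp [hn]
      · simp [hw q hq]
    rcases h with h | h
    · have := h (v \ {p}) (key _ (by intro q hq; simp [hq]))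
      simp at this
    · exact h (insert p v) (key _ (by intro q hq; simp [hq])) (by simp)
  · intro hr
    have key : ∀ w : Set P, v ∩ revealedTo owner s j = w ∩ revealedTo owner s j →
        (p ∈ v ↔ p ∈ w) := by
      intro w hw
      have := Set.ext_iff.mp hw p
      simpa [hr] using this
    by_cases hv : p ∈ v
    · exact Or.inl fun w hw => (key w hw).mp hv
    · exact Or.inr fun w hw hpw => hv ((key w hw).mpr hpw)

/-- `Kw_i Kw_j p_k` is valid. -/
theorem kw_kw_valid {ι P : Type} [Fintype ι] [Fintype P] (owner : P → ι)
    (i j k : ι) (p : P) (hp : owner p = k) (v : Set P) (s : Profile owner) :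
    sat owner v s (Form.Kw i (Form.Kw j (.atom p))) := by
  by_cases h : p ∈ revealedTo owner s j
  · exact Or.inl fun w _ => (sat_kw_atom_iff owner j p w s).mpr h
  · exact Or.inr fun w _ hw => h ((sat_kw_atom_iff owner j p w s).mp hw)
end

section
/- A uniform strategy profile 𝐬 is a maximal Nash equilibrium of the observation game G (i.e., 𝐬 ∈ NE_max(G)) if and only if for every valuation v ∈ V, the strategy profile 𝐬(v) is a Nash equilibrium of the pointed game G(v). -/
open Classical

/-- a uniform strategy profile is a maximal Nash equilibrium of `G` iff
for every valuation `v`, the strategy profile `us(v)` is a Nash equilibrium of the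
pointed game `G(v)`. -/
theorem NEmax_iff_pointedNE {ι P : Type} [Fintype ι] [Fintype P] [DecidableEq ι]
    (owner : P → ι) (γ : ι → Form ι P) (us : UProfile owner)
    (hus : ∀ i, IsUniform owner i (us i)) :
    NEmax owner (fun i v s => sat owner v s (γ i)) us ↔
      ∀ v : Set P, pointedNE owner (fun i v s => sat owner v s (γ i)) v (applyU owner us v) := by
  have key : ∀ (i : ι) (f : Set P → Strategy owner i) (w : Set P),
      applyU owner (Function.update us i f) w
        = Function.update (applyU owner us w) i (f w) := by
    intro i f w
    funext j
    by_cases h : j = i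
    · subst h; simp [applyU]
    · simp [applyU, Function.update_of_ne h]
  constructor
  · rintro ⟨-, h⟩ v i s'
    by_contra hlt
    refine h i (fun _ => s') (fun _ _ _ => rfl) v ⟨v, rfl, ?_⟩
    rw [key]
    exact not_le.mp hlt
  · intro h
    refine ⟨hus, ?_⟩
    rintro i f - v ⟨w, -, hw⟩
    rw [key] at hw
    exact absurd (h w i (f w)) (not_le.mpr hw)
end

section
/- Let G_B be the Kw game associated with a Boolean game B = (N,(P_i),(γ_i)). Then for all players i ∈ N and all valuations w ∈ V: s^w ⊨ λ(γ_i) (in the epistemic semantics) if and only if w ⊨ γ_i (classical propositional satisfaction). -/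
open Classical

theorem kwHolds_iff_revealed {ι P : Type} (owner : P → ι) (v : Set P) (s : Profile owner)
    (j : ι) (p : P) : kwHolds owner v s j p ↔ p ∈ revealedTo owner s j := by
  constructor
  · intro h
    by_contra hp
    have h1 : obsRel owner s j v (v ∪ {p}) := by
      unfold obsRel
      ext q
      simp only [Set.mem_inter_iff, Set.mem_union, Set.mem_singleton_iff]
      constructor
      · rintro ⟨a, b⟩; exact ⟨Or.inl a, b⟩
      · rintro ⟨a | a, b⟩
        · exact ⟨a, b⟩
        · subst a; exact absurd b hp
    have h2 : obsRel owner s j v (v \ {p}) := by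
      unfold obsRel
      ext q
      simp only [Set.mem_inter_iff, Set.mem_diff, Set.mem_singleton_iff]
      constructor
      · rintro ⟨a, b⟩
        refine ⟨⟨a, ?_⟩, b⟩
        rintro rfl
        exact hp b
      · rintro ⟨⟨a, _⟩, b⟩; exact ⟨a, b⟩
    rcases h with h | h
    · exact (h _ h2).2 rfl
    · exact h _ h1 (Or.inr rfl)
  · intro hp
    have key : ∀ u, obsRel owner s j v u → (p ∈ v ↔ p ∈ u) := by
      intro u hu
      have := Set.ext_iff.mp hu p
      simpa [hp] using this
    by_cases hv : p ∈ v
    · exact Or.inl fun u hu => (key u hu).1 hv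
    · exact Or.inr fun u hu hpu => hv ((key u hu).2 hpu)

theorem revealed_profOf {P : Type} {n : ℕ} [NeZero n] (hn : 2 ≤ n)
    (owner : P → Fin n) (w : Set P) (p : P) :
    p ∈ revealedTo owner (profOf owner w) (owner p + 1) ↔ p ∈ w := by
  have hne : owner p + 1 ≠ owner p := by
    intro h
    have h1 : (1 : Fin n) = 0 := by simpa using h
    have h2 := congrArg Fin.val h1
    rw [Fin.val_one', Fin.val_zero, Nat.mod_eq_of_lt (by omega)] at h2
    omega
  constructor
  · rintro ⟨j, hj⟩
    have ho : owner p = j := (profOf owner w j).reveal_subset _ hj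
    subst ho
    simp only [profOf, if_neg hne, if_true] at hj
    exact hj.2
  · intro hp
    refine ⟨owner p, ?_⟩
    simp only [profOf, if_neg hne, if_true]
    exact ⟨rfl, hp⟩

theorem ksat_lam_iff {P : Type} {n : ℕ} [NeZero n] (hn : 2 ≤ n)
    (owner : P → Fin n) (w v : Set P) (α : BForm P) :
    ksat owner v (profOf owner w) (lam owner α) ↔ bsat w α := by
  induction α with
  | atom p => exact (kwHolds_iff_revealed owner v _ _ p).trans (revealed_profOf hn owner w p)
  | neg α ih => exact not_congr ih
  | or α β iha ihb => exact or_congr iha ihb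

/-- `s^w ⊨ λ(γ_i)` iff `w ⊨ γ_i`. -/
theorem lam_outcome {P : Type} {n : ℕ} [NeZero n] [Fintype P] (hn : 2 ≤ n)
    (owner : P → Fin n) (γ : Fin n → BForm P) (i : Fin n) (w : Set P) :
    (∀ v : Set P, ksat owner v (profOf owner w) (lam owner (γ i))) ↔ bsat w (γ i) := by
  exact ⟨fun h => (ksat_lam_iff hn owner w ∅ (γ i)).1 (h ∅),
    fun h v => (ksat_lam_iff hn owner w v (γ i)).2 h⟩
end

section
/- Let G be a Kw game, let 𝐬 ∈ NE_max(G) be a maximal Nash equilibrium, let v ∈ V, and set s = 𝐬(v). Then the globally uniform strategy profile ṡ is also a maximal Nash equilibrium of G: ṡ ∈ NE_max(G). -/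
open Classical

/-- Satisfaction of knowing-whether formulas does not depend on the valuation. -/
theorem ksat_valuation_irrel {ι P : Type} (owner : P → ι) (v w : Set P) (s : Profile owner)
    (α : KwForm ι P) : ksat owner v s α ↔ ksat owner w s α := by
  induction α with
  | kw j p => simp only [ksat, kwHolds_iff_revealed]
  | neg α ih => simp only [ksat, ih]
  | or α β iha ihb => simp only [ksat, iha, ihb]

/-- in a Kw game, if `us ∈ NE_max(G)` and `s = us(v)`, then the globally
uniform strategy profile `ṡ` is also a maximal Nash equilibrium. -/
theorem NEmax_globalize {ι P : Type} [Fintype ι] [Fintype P] [DecidableEq ι]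
    (owner : P → ι) (γ : ι → KwForm ι P) (us : UProfile owner)
    (h : NEmax owner (fun i v s => ksat owner v s (γ i)) us) (v : Set P) :
    NEmax owner (fun i v s => ksat owner v s (γ i)) (fun i _ => us i v) := by
  refine ⟨fun _ _ _ _ => rfl, ?_⟩
  rintro i f hf v' ⟨w, _, hgt⟩
  refine h.2 i (fun _ => f w) (fun _ _ _ => rfl) v ⟨v, rfl, ?_⟩
  have e1 : applyU owner (Function.update (fun i _ => us i v) i f) w
      = applyU owner (Function.update us i (fun _ => f w)) v := by
    funext k
    unfold applyU
    by_cases hk : k = i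
    · subst hk
      simp
    · simp [Function.update_of_ne hk]
  have e2 : applyU owner (fun i _ => us i v) w = applyU owner us v := rfl
  rw [e1, e2] at hgt
  simp only [outcome, ksat_valuation_irrel owner w v] at hgt ⊢
  exact hgt
end

section
/- In the Kw game G_B associated with a Boolean game B, the outcome is constant on equivalence classes of ≡: for every globally uniform strategy profile 𝐬 ∈ 𝐒^g, for all 𝐭 ∈ [𝐬], for all players i ∈ N, and for all valuations v ∈ V, u_i(v,𝐬(v)) = u_i(v,𝐭(v)). -/
open Classical

theorem kwHolds_iff_aux {ι P : Type} (owner : P → ι) (v : Set P) (s : Profile owner)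
    (j : ι) (p : P) : kwHolds owner v s j p ↔ p ∈ (s (owner p)).reveal j := by
  constructor
  · intro h
    by_contra hp
    have hn : p ∉ revealedTo owner s j := by
      rintro ⟨k, hk⟩
      have hko : owner p = k := (s k).reveal_subset j hk
      subst hko
      exact hp hk
    rcases h with h | h
    · have := h (v \ {p}) (by
        unfold obsRel
        ext q
        by_cases hq : q = p
        · subst hq; simp [hn]
        · simp [hq])
      simp at this
    · have := h (insert p v) (by
        unfold obsRel
        ext q
        by_cases hq : q = p
        · subst hq; simp [hn]
        · simp [hq])
      simp at this
  · intro hp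
    have hr : p ∈ revealedTo owner s j := ⟨_, hp⟩
    have key : ∀ w, obsRel owner s j v w → (p ∈ v ↔ p ∈ w) := by
      intro w hw
      have := Set.ext_iff.mp hw p
      simpa [hr] using this
    by_cases hv : p ∈ v
    · exact Or.inl fun w hw => (key w hw).mp hv
    · exact Or.inr fun w hw hpw => hv ((key w hw).mpr hpw)

theorem ksat_lam_congr_aux {P : Type} {n : ℕ} [NeZero n] (owner : P → Fin n)
    (v : Set P) (s t : Profile owner)
    (h : ∀ i, (s i).reveal (i + 1) = (t i).reveal (i + 1)) (α : BForm P) :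
    ksat owner v s (lam owner α) ↔ ksat owner v t (lam owner α) := by
  induction α with
  | atom p => simp only [lam, ksat, kwHolds_iff_aux, h]
  | neg α ih => simp only [lam, ksat, ih]
  | or α β iha ihb => simp only [lam, ksat, iha, ihb]

/-- in `G_B`, the outcome is constant on `≡`-equivalence classes of
globally uniform strategy profiles. -/
theorem outcome_const_on_equiv {P : Type} {n : ℕ} [NeZero n] [Fintype P]
    (owner : P → Fin n) (γ : Fin n → BForm P) (us ut : UProfile owner)
    (hus : ∀ i, IsGUniform owner i (us i)) (hut : ∀ i, IsGUniform owner i (ut i))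
    (heq : ∀ (i : Fin n) (v : Set P), (us i v).reveal (i + 1) = (ut i v).reveal (i + 1)) :
    ∀ (i : Fin n) (v : Set P),
      outcome owner (fun j u s => ksat owner u s (lam owner (γ j))) i v (applyU owner us v) =
      outcome owner (fun j u s => ksat owner u s (lam owner (γ j))) i v (applyU owner ut v) := by
  intro i v
  have h := ksat_lam_congr_aux owner v (applyU owner us v) (applyU owner ut v)
    (fun i => heq i v) (γ i)
  unfold outcome
  simp only [h]
end

section
/- Let B be a Boolean game and G_B the associated Kw game. Then NE_max(G_B) ≠ ∅ if and only if NE(B) ≠ ∅ (the Kw game has a maximal Nash equilibrium iff the Boolean game has a Nash equilibrium). -/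
open Classical

/-- The valuation encoded by a strategy profile. -/
def valOf {P : Type} {n : ℕ} [NeZero n] (owner : P → Fin n) (s : Profile owner) : Set P :=
  {p | p ∈ (s (owner p)).reveal (owner p + 1)}

theorem kwHolds_iff_mem {P : Type} {n : ℕ} (owner : P → Fin n)
    (v : Set P) (s : Profile owner) (j : Fin n) (p : P) :
    kwHolds owner v s j p ↔ p ∈ (s (owner p)).reveal j := by
  have key : p ∈ revealedTo owner s j ↔ p ∈ (s (owner p)).reveal j := by
    constructor
    · rintro ⟨k, hk⟩
      have h : owner p = k := (s k).reveal_subset j hk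
      subst h
      exact hk
    · intro h
      exact ⟨_, h⟩
  rw [← key]
  constructor
  · intro h
    by_contra hp
    have h1 : obsRel owner s j v (v ∪ {p}) := by
      ext q
      simp only [Set.mem_inter_iff, Set.mem_union, Set.mem_singleton_iff]
      constructor
      · rintro ⟨a, b⟩
        exact ⟨Or.inl a, b⟩
      · rintro ⟨a | a, b⟩
        · exact ⟨a, b⟩
        · subst a
          exact absurd b hp
    have h2 : obsRel owner s j v (v \ {p}) := by
      ext q
      simp only [Set.mem_inter_iff, Set.mem_diff, Set.mem_singleton_iff]
      constructor
      · rintro ⟨a, b⟩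
        refine ⟨⟨a, ?_⟩, b⟩
        intro c
        subst c
        exact hp b
      · rintro ⟨a, b⟩
        exact ⟨a.1, b⟩
    rcases h with h | h
    · exact (h _ h2).2 rfl
    · exact h _ h1 (Or.inr rfl)
  · intro hp
    have hw : ∀ w, obsRel owner s j v w → (p ∈ v ↔ p ∈ w) := by
      intro w hw
      have h := Set.ext_iff.mp hw p
      simpa [hp] using h
    by_cases hv : p ∈ v
    · exact Or.inl fun w h => (hw w h).1 hv
    · exact Or.inr fun w h hpw => hv ((hw w h).2 hpw)

theorem ksat_lam {P : Type} {n : ℕ} [NeZero n] (owner : P → Fin n)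
    (v : Set P) (s : Profile owner) (α : BForm P) :
    ksat owner v s (lam owner α) ↔ bsat (valOf owner s) α := by
  induction α with
  | atom p => exact kwHolds_iff_mem owner v s _ p
  | neg α ih => exact not_congr ih
  | or α β iha ihb => exact or_congr iha ihb

theorem outcome_eq {P : Type} {n : ℕ} [NeZero n] (owner : P → Fin n) (γ : Fin n → BForm P)
    (i : Fin n) (v : Set P) (s : Profile owner) :
    outcome owner (fun i v s => ksat owner v s (lam owner (γ i))) i v s
      = bOutcome owner γ i (valOf owner s) := by
  simp only [outcome, bOutcome, ksat_lam]

theorem valOf_profOf {P : Type} {n : ℕ} [NeZero n] (owner : P → Fin n)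
    (hn : ∀ i : Fin n, i + 1 ≠ i) (w : Set P) : valOf owner (profOf owner w) = w := by
  ext p
  simp [valOf, profOf, hn]

theorem valOf_update {P : Type} {n : ℕ} [NeZero n] (owner : P → Fin n)
    (us : UProfile owner) (i : Fin n) (f : Set P → Strategy owner i) (w : Set P) :
    valOf owner (applyU owner (Function.update us i f) w)
      = bDeviate owner (valOf owner (applyU owner us w)) i ((f w).reveal (i + 1)) := by
  ext p
  simp only [valOf, applyU, bDeviate, Set.mem_ofPred_eq]
  by_cases h : owner p = i
  · subst h
    simp
  · simp [h]

/-- `NE_max(G_B) ≠ ∅` iff `NE(B) ≠ ∅`. -/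
theorem NEmax_GB_iff_NE_B {P : Type} {n : ℕ} [NeZero n] [Fintype P]
    (owner : P → Fin n) (γ : Fin n → BForm P) :
    (∃ us : UProfile owner,
        NEmax owner (fun i v s => ksat owner v s (lam owner (γ i))) us) ↔
      (∃ v : Set P, BNE owner γ v) := by
  rcases Nat.lt_or_ge 1 n with h1 | h1
  · have hn : ∀ i : Fin n, i + 1 ≠ i := by
      intro i h
      have h0 : (1 : Fin n) = 0 := by simpa using h
      have h2 := congrArg Fin.val h0
      rw [Fin.val_one', Nat.mod_eq_of_lt h1] at h2
      simp at h2
    constructor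
    · rintro ⟨us, hU, hus⟩
      refine ⟨valOf owner (applyU owner us ∅), fun i vi => ?_⟩
      have h := hus i (fun _ => profOf owner vi i) (fun _ _ _ => rfl) ∅
      by_contra hlt
      refine h ⟨∅, rfl, ?_⟩
      rw [outcome_eq, outcome_eq, valOf_update]
      have e : bDeviate owner (valOf owner (applyU owner us ∅)) i
          ((profOf owner vi i).reveal (i + 1))
          = bDeviate owner (valOf owner (applyU owner us ∅)) i vi := by
        ext p
        simp only [bDeviate, Set.mem_ofPred_eq]
        by_cases hp : owner p = i
        · simp [hp, profOf, hn]
        · simp [hp]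
      rw [e]
      exact not_le.mp hlt
    · rintro ⟨v, hv⟩
      refine ⟨fun i _ => profOf owner v i, fun i _ _ _ => rfl, ?_⟩
      rintro i f hf w ⟨w', hw', hlt⟩
      rw [outcome_eq, outcome_eq, valOf_update] at hlt
      have e : valOf owner (applyU owner (fun i _ => profOf owner v i) w') = v :=
        valOf_profOf owner hn v
      rw [e] at hlt
      exact absurd (hv i _) (not_le.mpr hlt)
  · have hn : n = 1 := le_antisymm h1 (Nat.pos_of_ne_zero (NeZero.ne n))
    subst hn
    constructor
    · intro _
      by_cases hs : ∃ v, bsat v (γ 0)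
      · obtain ⟨v, hv⟩ := hs
        refine ⟨v, fun i vi => ?_⟩
        obtain rfl : i = 0 := Subsingleton.elim _ _
        simp only [bOutcome, if_pos hv]
        split_ifs <;> simp
      · refine ⟨∅, fun i vi => ?_⟩
        obtain rfl : i = 0 := Subsingleton.elim _ _
        have h2 : ∀ v, ¬ bsat v (γ 0) := fun v hv => hs ⟨v, hv⟩
        simp [bOutcome, h2]
    · intro _
      have hall : ∀ s : Profile owner, valOf owner s = Set.univ := by
        intro s
        ext p
        have e : owner p + 1 = owner p := Subsingleton.elim _ _
        simp only [valOf, Set.mem_ofPred_eq, Set.mem_univ, iff_true]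
        rw [e, (s (owner p)).reveal_self]
        rfl
      refine ⟨fun i _ => profOf owner ∅ i, fun i _ _ _ => rfl, ?_⟩
      rintro i f hf w ⟨w', hw', hlt⟩
      rw [outcome_eq, outcome_eq, hall, hall] at hlt
      exact lt_irrefl _ hlt
end
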